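/- arXiv:2304.13405 — 2 statements merged into one kernel-verified Lean document; each statement's English description precedes it below -/
import Mathlib

section
/- For two agents with additive normalized valuations (v_i(M) = 2), no deterministic online algorithm for allocating goods achieves a competitive ratio strictly greater than 1/2 with respect to MMS. Concretely: for every δ > 0, there is an adaptively constructed sequence of items such that any deterministic online allocation fails to give both agents value at least (1/2 + δ)·MMS_i. -/
open Finset

/-- Additive value/cost of a bundle of items. -/
def bundleVal {ι : Type*} (v : ι → ℝ) (S : Finset ι) : ℝ := ∑ e ∈ S, v e

/-- `X` is an `n`-partition of the item set `M`. -/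
def IsPartition {ι : Type*} [DecidableEq ι] {n : ℕ} (M : Finset ι) (X : Fin n → Finset ι) : Prop :=
  (Pairwise fun i j => Disjoint (X i) (X j)) ∧ Finset.univ.biUnion X = M

/-- Maximin share for goods: the max over `n`-partitions of the minimum bundle value. -/
noncomputable def MMSgoods {ι : Type*} [DecidableEq ι] (n : ℕ) (M : Finset ι) (v : ι → ℝ) : ℝ :=
  sSup {x : ℝ | ∃ X : Fin n → Finset ι, IsPartition M X ∧
    x = sInf (Set.range fun j => bundleVal v (X j))}

/-- Maximin share for chores: the min over `n`-partitions of the maximum bundle cost. -/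
noncomputable def MMSchores {ι : Type*} [DecidableEq ι] (n : ℕ) (M : Finset ι) (c : ι → ℝ) : ℝ :=
  sInf {x : ℝ | ∃ X : Fin n → Finset ι, IsPartition M X ∧
    x = sSup (Set.range fun j => bundleVal c (X j))}
/-- Value of an item (a pair of the two agents' values) to agent `a`. -/
def agentVal (p : ℝ × ℝ) (a : Bool) : ℝ := if a then p.1 else p.2

/-- The total value that agent `a` receives when the deterministic online algorithm `alg`
(mapping the history of items seen so far, the current item last, to the agent who
irrevocably receives the current item) processes the item sequence `L`. -/
noncomputable def onlineAlloc (alg : List (ℝ × ℝ) → Bool) (L : List (ℝ × ℝ)) (a : Bool) : ℝ :=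
  ∑ k : Fin L.length, if alg (L.take (k.1 + 1)) = a then agentVal (L.get k) a else 0

/-- Maximin share of agent `a` for the instance given by the item list `L` with two agents. -/
noncomputable def listMMS (L : List (ℝ × ℝ)) (a : Bool) : ℝ :=
  MMSgoods 2 (Finset.univ : Finset (Fin L.length)) (fun k => agentVal (L.get k) a)

/-- The item worth `u` to agent `g` and `w` to the other agent. -/
def mkItem (g : Bool) (u w : ℝ) : ℝ × ℝ := if g then (u, w) else (w, u)

lemma agentVal_mk_self (g : Bool) (u w : ℝ) : agentVal (mkItem g u w) g = u := by
  cases g <;> simp [agentVal, mkItem]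

lemma agentVal_mk_not (g : Bool) (u w : ℝ) : agentVal (mkItem g u w) (!g) = w := by
  cases g <;> simp [agentVal, mkItem]

lemma sum_left (f : ℝ × ℝ → ℝ) (P T : List (ℝ × ℝ)) :
    (∑ k : Fin (P ++ T).length, if k.1 < P.length then f ((P ++ T).get k) else 0)
      = (P.map f).sum := by
  induction P with
  | nil => simp
  | cons p P ih =>
    have := Fin.sum_univ_succ (n := (P ++ T).length)
      (fun k => if k.1 < (p :: P).length then f ((p :: (P ++ T)).get k) else 0)
    refine this.trans ?_
    rw [List.map_cons, List.sum_cons, ← ih]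
    simp

lemma sum_right (f : ℝ × ℝ → ℝ) (P T : List (ℝ × ℝ)) :
    (∑ k : Fin (P ++ T).length, if ¬ k.1 < P.length then f ((P ++ T).get k) else 0)
      = (T.map f).sum := by
  induction P with
  | nil =>
    simp only [List.length_nil, Nat.not_lt_zero, not_false_eq_true, if_true]
    change ∑ k : Fin T.length, f (T.get k) = _
    simp [← List.sum_ofFn]
  | cons p P ih =>
    have := Fin.sum_univ_succ (n := (P ++ T).length)
      (fun k => if ¬ k.1 < (p :: P).length then f ((p :: (P ++ T)).get k) else 0)
    refine this.trans ?_
    rw [← ih]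
    simp

lemma sum_snoc (L : List (ℝ × ℝ)) (p : ℝ × ℝ) : ∀ F : ℕ → ℝ × ℝ → ℝ,
    (∑ k : Fin (L ++ [p]).length, F k.1 ((L ++ [p]).get k))
      = (∑ k : Fin L.length, F k.1 (L.get k)) + F L.length p := by
  induction L with
  | nil => intro F; simp
  | cons q L ih =>
    intro F
    have h1 := Fin.sum_univ_succ (n := (L ++ [p]).length)
      (fun k => F k.1 ((q :: (L ++ [p])).get k))
    have h2 := Fin.sum_univ_succ (n := L.length) (fun k => F k.1 ((q :: L).get k))
    refine h1.trans ?_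
    refine Eq.trans ?_ (congrArg (· + F (q :: L).length p) h2.symm)
    have h3 := ih (fun n x => F (n + 1) x)
    simp only [Fin.val_succ, List.length_cons, List.get_cons_succ', Fin.val_zero] at h3 ⊢
    rw [h3]
    simp [add_assoc]

lemma onlineAlloc_snoc (alg : List (ℝ × ℝ) → Bool) (L : List (ℝ × ℝ)) (p : ℝ × ℝ) (a : Bool) :
    onlineAlloc alg (L ++ [p]) a
      = onlineAlloc alg L a + if alg (L ++ [p]) = a then agentVal p a else 0 := by
  unfold onlineAlloc
  rw [sum_snoc L p (fun n x => if alg ((L ++ [p]).take (n + 1)) = a then agentVal x a else 0)]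
  congr 1
  · apply Finset.sum_congr rfl
    intro k _
    rw [List.take_append_of_le_length (by have := k.2; omega)]
  · rw [List.take_of_length_le (by simp)]

lemma le_listMMS (P T : List (ℝ × ℝ)) (a : Bool) (m : ℝ)
    (hP : m ≤ (P.map (agentVal · a)).sum) (hT : m ≤ (T.map (agentVal · a)).sum) :
    m ≤ listMMS (P ++ T) a := by
  unfold listMMS MMSgoods
  set v : Fin (P ++ T).length → ℝ := fun k => agentVal ((P ++ T).get k) a with hv
  let X : Fin 2 → Finset (Fin (P ++ T).length) :=
    ![Finset.univ.filter (fun k => k.1 < P.length), Finset.univ.filter (fun k => ¬ k.1 < P.length)]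
  have hX : IsPartition (Finset.univ : Finset (Fin (P ++ T).length)) X := by
    constructor
    · intro i j hij
      have h := Finset.disjoint_filter_filter_not (Finset.univ : Finset (Fin (P ++ T).length))
        Finset.univ (fun k => k.1 < P.length)
      fin_cases i <;> fin_cases j
      · exact absurd rfl hij
      · exact h
      · exact h.symm
      · exact absurd rfl hij
    · ext k
      simp only [Finset.mem_biUnion, Finset.mem_univ, true_and, iff_true, Fin.exists_fin_two]
      by_cases h : k.1 < P.length
      · left; simp [X, h]
      · right; simp [X]; omega
  have hb : BddAbove {x : ℝ | ∃ X : Fin 2 → Finset (Fin (P ++ T).length),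
      IsPartition Finset.univ X ∧ x = sInf (Set.range fun j => bundleVal v (X j))} := by
    apply Set.Finite.bddAbove
    apply (Set.finite_range (fun X : Fin 2 → Finset (Fin (P ++ T).length) =>
      sInf (Set.range fun j => bundleVal v (X j)))).subset
    rintro x ⟨X, _, rfl⟩
    exact ⟨X, rfl⟩
  refine le_trans ?_ (le_csSup hb ⟨X, hX, rfl⟩)
  apply le_csInf (Set.range_nonempty _)
  rintro _ ⟨j, rfl⟩
  fin_cases j
  · change m ≤ ∑ e ∈ Finset.univ.filter (fun k : Fin (P ++ T).length => k.1 < P.length), v e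
    rw [Finset.sum_filter]
    exact hP.trans (sum_left (agentVal · a) P T).ge
  · change m ≤ ∑ e ∈ Finset.univ.filter (fun k : Fin (P ++ T).length => ¬ k.1 < P.length), v e
    rw [Finset.sum_filter]
    exact hT.trans (sum_right (agentVal · a) P T).ge

/-- The adversary's doubling phase. -/
noncomputable def seqL (g : Bool) (α y : ℝ) : ℕ → List (ℝ × ℝ)
  | 0 => [(y, y)]
  | k + 1 => seqL g α y k ++ [mkItem g (α * ((1 + α) ^ k * y)) (2 ^ k * y)]

lemma seqL_sum_self (g : Bool) (α y : ℝ) (k : ℕ) :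
    ((seqL g α y k).map (agentVal · g)).sum = (1 + α) ^ k * y := by
  induction k with
  | zero => simp [seqL, agentVal]
  | succ k ih => simp only [seqL, List.map_append, List.sum_append, ih, List.map_cons,
      List.map_nil, List.sum_cons, List.sum_nil, agentVal_mk_self]; ring

lemma seqL_sum_not (g : Bool) (α y : ℝ) (k : ℕ) :
    ((seqL g α y k).map (agentVal · (!g))).sum = 2 ^ k * y := by
  induction k with
  | zero => simp [seqL, agentVal]
  | succ k ih => simp only [seqL, List.map_append, List.sum_append, ih, List.map_cons,
      List.map_nil, List.sum_cons, List.sum_nil, agentVal_mk_not]; ring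

lemma mkItem_nonneg (g : Bool) {u w : ℝ} (hu : 0 ≤ u) (hw : 0 ≤ w) :
    0 ≤ (mkItem g u w).1 ∧ 0 ≤ (mkItem g u w).2 := by
  cases g <;> simp [mkItem, hu, hw]

lemma seqL_nonneg (g : Bool) {α y : ℝ} (hα : 0 ≤ α) (hy : 0 ≤ y) (k : ℕ) :
    ∀ p ∈ seqL g α y k, 0 ≤ p.1 ∧ 0 ≤ p.2 := by
  induction k with
  | zero => simp [seqL, hy]
  | succ k ih =>
    intro p hp
    simp only [seqL, List.mem_append, List.mem_singleton] at hp
    rcases hp with hp | rfl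
    · exact ih p hp
    · exact mkItem_nonneg g (by positivity) (by positivity)

lemma sums_of_agent (g : Bool) (L : List (ℝ × ℝ)) (h1 : (L.map (agentVal · g)).sum = 2)
    (h2 : (L.map (agentVal · (!g))).sum = 2) :
    (L.map Prod.fst).sum = 2 ∧ (L.map Prod.snd).sum = 2 := by
  cases g
  · exact ⟨by simpa [agentVal] using h2, by simpa [agentVal] using h1⟩
  · exact ⟨by simpa [agentVal] using h1, by simpa [agentVal] using h2⟩

theorem stmt6 : ∀ δ : ℝ, 0 < δ → ∀ alg : List (ℝ × ℝ) → Bool,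
    ∃ L : List (ℝ × ℝ),
      (∀ p ∈ L, 0 ≤ p.1 ∧ 0 ≤ p.2) ∧
      (L.map Prod.fst).sum = 2 ∧ (L.map Prod.snd).sum = 2 ∧
      ¬ (∀ a : Bool, (1/2 + δ) * listMMS L a ≤ onlineAlloc alg L a) := by
  intro δ hδ alg
  by_contra hcon
  have H : ∀ g : Bool, ∀ L : List (ℝ × ℝ), (∀ p ∈ L, 0 ≤ p.1 ∧ 0 ≤ p.2) →
      (L.map (agentVal · g)).sum = 2 → (L.map (agentVal · (!g))).sum = 2 →
      ∀ a : Bool, (1/2 + δ) * listMMS L a ≤ onlineAlloc alg L a := by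
    intro g L h0 h1 h2
    by_contra hn
    obtain ⟨h3, h4⟩ := sums_of_agent g L h1 h2
    exact hcon ⟨L, h0, h3, h4, hn⟩
  clear hcon
  obtain ⟨α, hα0, hα1, hα⟩ : ∃ α : ℝ, 0 < α ∧ α < 1 ∧ 1 < (1/2 + δ) * (1 + α) := by
    refine ⟨1 / (1 + δ), by positivity, ?_, ?_⟩
    · rw [div_lt_one (by positivity)]; linarith
    · have : (1/2 + δ) * (1 + 1 / (1 + δ)) = (1 + 5/2 * δ + δ^2) / (1 + δ) := by
        field_simp; ring
      rw [this, lt_div_iff₀ (by positivity)]; nlinarith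
  obtain ⟨N, hN⟩ := exists_pow_lt_of_lt_one (show (0:ℝ) < 1/2 by norm_num)
    (show (1 + α) / 2 < 1 by linarith)
  obtain ⟨y, hy0, hyN⟩ : ∃ y : ℝ, 0 < y ∧ 2 ^ N * y = 1 :=
    ⟨(2 ^ N)⁻¹, by positivity, by field_simp⟩
  have hxN : (1 + α) ^ N * y < 1/2 := by
    have : (1 + α) ^ N * y = ((1 + α) / 2) ^ N := by
      rw [div_pow, eq_div_iff (by positivity)]; linear_combination (1 + α) ^ N * hyN
    rw [this]; exact hN
  set g := alg [(y, y)] with hg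
  have hgn : g ≠ !g := by cases g <;> simp
  have key : ∀ k ≤ N, onlineAlloc alg (seqL g α y k) g = (1 + α) ^ k * y ∧
      onlineAlloc alg (seqL g α y k) (!g) = 0 := by
    intro k
    induction k with
    | zero =>
      intro _
      have h : ∀ a, onlineAlloc alg (seqL g α y 0) a = if g = a then y else 0 := by
        intro a
        have := onlineAlloc_snoc alg [] (y, y) a
        simp only [List.nil_append] at this
        change onlineAlloc alg [(y, y)] a = _
        rw [this]
        simp [onlineAlloc, agentVal, hg]
      rw [h, h]
      simp
    | succ k ih =>
      intro hk
      obtain ⟨ih1, ih2⟩ := ih (by omega)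
      have s1 : ∀ a, onlineAlloc alg (seqL g α y (k+1)) a = _ := fun a =>
        onlineAlloc_snoc alg (seqL g α y k) (mkItem g (α * ((1 + α) ^ k * y)) (2 ^ k * y)) a
      have hxy : (1 + α) ^ (k+1) * y ≤ 2 ^ (k+1) * y := by
        gcongr; linarith
      have hy1 : (2:ℝ) ^ (k+1) * y ≤ 1 := by
        rw [← hyN]; gcongr; norm_num
      have hx0 : 0 < (1 + α) ^ k * y := by positivity
      have hz0 : 0 < 2 ^ k * y := by positivity
      by_cases hc : alg (seqL g α y (k+1)) = g
      · have e1 := s1 g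
        have e2 := s1 (!g)
        change _ = _ + (if alg (seqL g α y (k+1)) = _ then _ else _) at e1 e2
        rw [hc, if_pos rfl, ih1, agentVal_mk_self] at e1
        rw [hc, if_neg hgn, ih2] at e2
        exact ⟨by rw [e1]; ring, by rw [e2]; ring⟩
      · exfalso
        have hc' : alg (seqL g α y (k+1)) = !g := by
          revert hc; cases alg (seqL g α y (k+1)) <;> cases g <;> simp
        have e1 := s1 g
        have e2 := s1 (!g)
        change _ = _ + (if alg (seqL g α y (k+1)) = _ then _ else _) at e1 e2
        rw [if_neg hc, ih1] at e1
        rw [if_pos hc', ih2, agentVal_mk_not] at e2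
        set b := mkItem g (2 - (1 + α) ^ (k+1) * y) (2 - 2 ^ (k+1) * y) with hb
        have hh := H g (seqL g α y (k+1) ++ [b]) (by
            intro p hp
            rw [List.mem_append, List.mem_singleton] at hp
            rcases hp with hp | rfl
            · exact seqL_nonneg g hα0.le hy0.le _ p hp
            · exact mkItem_nonneg g (by linarith) (by linarith))
          (by simp only [List.map_append, List.sum_append, seqL_sum_self, List.map_cons,
                List.map_nil, List.sum_cons, List.sum_nil, hb, agentVal_mk_self]; ring)
          (by simp only [List.map_append, List.sum_append, seqL_sum_not, List.map_cons,
                List.map_nil, List.sum_cons, List.sum_nil, hb, agentVal_mk_not]; ring)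
        have hm1 := le_listMMS (seqL g α y (k+1)) [b] g ((1 + α) ^ (k+1) * y)
          (seqL_sum_self ..).ge (by simp [hb, agentVal_mk_self]; linarith)
        have hm2 := le_listMMS (seqL g α y (k+1)) [b] (!g) (2 ^ (k+1) * y)
          (seqL_sum_not ..).ge (by simp [hb, agentVal_mk_not]; linarith)
        have h1 := hh g
        have h2 := hh (!g)
        rw [onlineAlloc_snoc] at h1 h2
        have hr : 0 < 1/2 + δ := by linarith
        have h3 := mul_le_mul_of_nonneg_left hm1 hr.le
        have h4 := mul_le_mul_of_nonneg_left hm2 hr.le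
        by_cases hd : alg (seqL g α y (k+1) ++ [b]) = g
        · rw [if_neg (by rw [hd]; exact hgn), e2] at h2
          rw [pow_succ] at h4
          nlinarith [mul_pos hδ hz0]
        · rw [if_neg hd, e1] at h1
          rw [pow_succ] at h3
          nlinarith [mul_pos (sub_pos.mpr hα) hx0]
  obtain ⟨k1, k2⟩ := key N le_rfl
  set S := seqL g α y N with hS
  set x := (1 + α) ^ N * y with hx
  have hx0 : 0 < x := by positivity
  set c := mkItem g (1 - x) (1/2) with hc
  set d := mkItem g 1 (1/2) with hd
  have sS1 : (S.map (agentVal · g)).sum = x := seqL_sum_self ..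
  have sS2 : (S.map (agentVal · (!g))).sum = 1 := (seqL_sum_not ..).trans hyN
  have hh := H g (S ++ [c] ++ [d]) (by
      intro p hp
      simp only [List.mem_append, List.mem_singleton] at hp
      rcases hp with (hp | rfl) | rfl
      · exact seqL_nonneg g hα0.le hy0.le _ p hp
      · exact mkItem_nonneg g (by linarith) (by norm_num)
      · exact mkItem_nonneg g (by norm_num) (by norm_num))
    (by simp only [List.map_append, List.sum_append, sS1, List.map_cons,
          List.map_nil, List.sum_cons, List.sum_nil, hc, hd, agentVal_mk_self]; ring)
    (by simp only [List.map_append, List.sum_append, sS2, List.map_cons,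
          List.map_nil, List.sum_cons, List.sum_nil, hc, hd, agentVal_mk_not]; ring)
  have hm1 := le_listMMS (S ++ [c]) [d] g 1
    (by simp [sS1, hc, agentVal_mk_self]) (by simp [hd, agentVal_mk_self])
  have hm2 := le_listMMS S ([c] ++ [d]) (!g) 1 sS2.ge
    (by simp [hc, hd, agentVal_mk_not]; norm_num)
  rw [← List.append_assoc] at hm2
  have h1 := hh g
  have h2 := hh (!g)
  have hr : 0 < 1/2 + δ := by linarith
  have h3 := mul_le_mul_of_nonneg_left hm1 hr.le
  have h4 := mul_le_mul_of_nonneg_left hm2 hr.le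
  rw [onlineAlloc_snoc, onlineAlloc_snoc, k1] at h1
  rw [onlineAlloc_snoc, onlineAlloc_snoc, k2, hc, hd, agentVal_mk_not, agentVal_mk_not,
    ← hc, ← hd] at h2
  by_cases q1 : alg (S ++ [c]) = g
  · rw [if_neg (by rw [q1]; exact hgn)] at h2
    split_ifs at h2 <;> linarith
  · by_cases q2 : alg (S ++ [c] ++ [d]) = g
    · rw [if_neg (c := alg (S ++ [c] ++ [d]) = !g) (by rw [q2]; exact hgn)] at h2
      split_ifs at h2 <;> linarith
    · rw [if_neg q1, if_neg q2] at h1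
      linarith
end

section
/- Small-good instances guarantee: let M be goods with v_i(e) ≤ α < 1 for all agents i and items e, and v_i(M) = n. If a partition (X_1, …, X_n) of M satisfies: every agent except possibly one last agent i* has 1 − α ≤ v_j(X_j), each such j had v_j(X_j minus its last item) < 1 − α, every e ∈ X_j (j ≠ i*) satisfies v_j(e) ≥ v_{i*}(e), then also v_{i*}(X_{i*}) > 1 ≥ MMS_{i*}; hence the allocation is (1 − α)-MMS. -/
open Finset

lemma bundleVal_partition {ι : Type*} [DecidableEq ι] {n : ℕ} {M : Finset ι}
    {X : Fin n → Finset ι} (h : IsPartition M X) (v : ι → ℝ) :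
    bundleVal v M = ∑ j, bundleVal v (X j) := by
  unfold bundleVal
  rw [← h.2, Finset.sum_biUnion]
  intro i _ j _ hij
  exact h.1 hij

lemma MMSgoods_le_one {ι : Type*} [DecidableEq ι] {n : ℕ} (hn : 2 ≤ n) {M : Finset ι}
    {v : ι → ℝ} (hv : bundleVal v M = n) : MMSgoods n M v ≤ 1 := by
  unfold MMSgoods
  apply Real.sSup_le _ zero_le_one
  rintro x ⟨Y, hY, rfl⟩
  by_contra! hlt
  have hall : ∀ j, 1 < bundleVal v (Y j) := fun j =>
    lt_of_lt_of_le hlt (csInf_le (Set.finite_range _).bddBelow ⟨j, rfl⟩)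
  have hs := bundleVal_partition hY v
  have : ∑ _j : Fin n, (1 : ℝ) < ∑ j, bundleVal v (Y j) :=
    Finset.sum_lt_sum_of_nonempty ⟨⟨0, by omega⟩, Finset.mem_univ _⟩ (fun j _ => hall j)
  simp at this
  linarith

theorem stmt11 {ι : Type*} [DecidableEq ι] (n : ℕ) (hn : 2 ≤ n) (α : ℝ) (hα : α < 1)
    (M : Finset ι) (X : Fin n → Finset ι) (hpart : IsPartition M X)
    (v : Fin n → ι → ℝ) (hv : ∀ i, ∀ e ∈ M, 0 ≤ v i e)
    (hsmall : ∀ i, ∀ e ∈ M, v i e ≤ α) (hnorm : ∀ i, bundleVal (v i) M = n)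
    (istar : Fin n)
    (h1 : ∀ j, j ≠ istar → 1 - α ≤ bundleVal (v j) (X j))
    (h2 : ∀ j, j ≠ istar → ∃ e ∈ X j, bundleVal (v j) ((X j).erase e) < 1 - α)
    (h3 : ∀ j, j ≠ istar → ∀ e ∈ X j, v istar e ≤ v j e) :
    1 < bundleVal (v istar) (X istar) ∧ MMSgoods n M (v istar) ≤ 1 ∧
      ∀ i, (1 - α) * MMSgoods n M (v i) ≤ bundleVal (v i) (X i) := by
  have hsub : ∀ j, X j ⊆ M := fun j => by
    rw [← hpart.2]; exact Finset.subset_biUnion_of_mem X (Finset.mem_univ j)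
  have hlt : ∀ j, j ≠ istar → bundleVal (v istar) (X j) < 1 := by
    intro j hj
    obtain ⟨e, he, hlt⟩ := h2 j hj
    have ha : bundleVal (v istar) (X j) ≤ bundleVal (v j) (X j) :=
      Finset.sum_le_sum (h3 j hj)
    have hb : bundleVal (v j) ((X j).erase e) + v j e = bundleVal (v j) (X j) :=
      Finset.sum_erase_add _ _ he
    have hc := hsmall j e (hsub j he)
    linarith
  have hcard : (Finset.univ.erase istar).card = n - 1 := by simp
  have hgt : 1 < bundleVal (v istar) (X istar) := by
    have hs := bundleVal_partition hpart (v istar)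
    rw [hnorm, ← Finset.sum_erase_add _ _ (Finset.mem_univ istar)] at hs
    have hne : (Finset.univ.erase istar).Nonempty := by
      rw [← Finset.card_pos, hcard]; omega
    have := Finset.sum_lt_sum_of_nonempty hne
      (fun j hj => hlt j (Finset.ne_of_mem_erase hj))
    rw [Finset.sum_const, hcard, nsmul_eq_mul, Nat.cast_sub (by omega)] at this
    push_cast at this
    linarith
  have hα0 : 0 ≤ α := by
    have hne : M.Nonempty := by
      rw [Finset.nonempty_iff_ne_empty]
      rintro rfl
      have := hnorm istar
      simp only [bundleVal, Finset.sum_empty] at this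
      have h0 : n = 0 := by exact_mod_cast this.symm
      omega
    obtain ⟨e, he⟩ := hne
    exact (hv istar e he).trans (hsmall istar e he)
  refine ⟨hgt, MMSgoods_le_one hn (hnorm istar), fun i => ?_⟩
  have hm : (1 - α) * MMSgoods n M (v i) ≤ (1 - α) * 1 :=
    mul_le_mul_of_nonneg_left (MMSgoods_le_one hn (hnorm i)) (by linarith)
  by_cases hi : i = istar
  · subst hi; linarith
  · have := h1 i hi
    linarith
end
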